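/- arXiv:0807.2129 — 3 statements merged into one kernel-verified Lean document; each statement's English description precedes it below -/
import Mathlib

section
/- Let H be a complex Hilbert space. Let F∗ denote the set of all self-adjoint F ∈ B(H) that are invertible modulo compact operators, i.e. there exists G ∈ B(H) with 1 − GF and 1 − FG compact; let F∗^{±1} denote the set of all F ∈ F∗ with ‖F‖ ≤ 1 and 1 − F² compact. Equip both sets with the operator-norm topology. Then F∗^{±1} is a deformation retract of F∗: there exists a continuous map r : [0,1] × F∗ → F∗ such that r(0,F) = F for every F ∈ F∗, r(1,F) ∈ F∗^{±1} for every F ∈ F∗, and r(1,F) = F for every F ∈ F∗^{±1}. -/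
set_option linter.unusedSectionVars false

section Helpers
open Filter Topology

variable {H : Type*} [NormedAddCommGroup H] [InnerProductSpace ℂ H] [CompleteSpace H]

/-- Compactness of an operator. -/
def Cpt (T : H →L[ℂ] H) : Prop := IsCompactOperator (T : H → H)

lemma Cpt.mul_left {T : H →L[ℂ] H} (h : Cpt T) (S : H →L[ℂ] H) : Cpt (S * T) :=
  IsCompactOperator.clm_comp (f := (T : H → H)) h S

lemma Cpt.mul_right {T : H →L[ℂ] H} (h : Cpt T) (S : H →L[ℂ] H) : Cpt (T * S) :=
  IsCompactOperator.comp_clm (f := (T : H → H)) h S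

lemma Cpt.smul' {T : H →L[ℂ] H} (h : Cpt T) (t : ℝ) : Cpt (t • T) :=
  IsCompactOperator.smul (f := (T : H → H)) h t

lemma cpt_zero : Cpt (0 : H →L[ℂ] H) := isCompactOperator_zero

lemma cpt_closed : IsClosed {T : H →L[ℂ] H | Cpt T} := isClosed_setOfPred_isCompactOperator

/-- The set of norms of approximate parametrix errors. -/
def errSet (F : H →L[ℂ] H) : Set ℝ :=
  {y | ∃ G E : H →L[ℂ] H, ‖G‖ ≤ 1 ∧ Cpt (1 - G * F - E) ∧ y = ‖E‖}

/-- The essential defect of `F`. -/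
noncomputable def defect (F : H →L[ℂ] H) : ℝ := sInf (errSet F)

lemma errSet_bdd (F : H →L[ℂ] H) : BddBelow (errSet F) :=
  ⟨0, by rintro y ⟨G, E, -, -, rfl⟩; exact norm_nonneg _⟩

lemma errSet_ne (F : H →L[ℂ] H) : (errSet F).Nonempty :=
  ⟨_, 0, 1, by simp, by simpa using cpt_zero, rfl⟩

lemma defect_nonneg (F : H →L[ℂ] H) : 0 ≤ defect F :=
  Real.sInf_nonneg (by rintro y ⟨G, E, -, -, rfl⟩; exact norm_nonneg _)

lemma defect_le (F F' : H →L[ℂ] H) : defect F' ≤ defect F + ‖F - F'‖ := by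
  rw [← sub_le_iff_le_add]
  refine le_csInf (errSet_ne F) ?_
  rintro y ⟨G, E, hG, hK, rfl⟩
  rw [sub_le_iff_le_add]
  refine (csInf_le (errSet_bdd F') ⟨G, E + G * (F - F'), hG, ?_, rfl⟩).trans ?_
  · convert hK using 1; noncomm_ring
  · refine (norm_add_le _ _).trans (add_le_add le_rfl ?_)
    refine (norm_mul_le _ _).trans ?_
    exact mul_le_of_le_one_left (norm_nonneg _) hG

lemma defect_cont : Continuous (defect : (H →L[ℂ] H) → ℝ) := by
  refine (LipschitzWith.of_le_add (f := defect) ?_).continuous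
  intro x y
  have := defect_le y x
  rwa [dist_comm, dist_eq_norm]

lemma defect_lt_one (F G : H →L[ℂ] H) (h : Cpt (1 - G * F)) : defect F < 1 := by
  have hp : 0 < ‖G‖ + 1 := by positivity
  set t : ℝ := (‖G‖ + 1)⁻¹ with ht
  have ht0 : 0 < t := inv_pos.2 hp
  have ht1 : t ≤ 1 := inv_le_one_of_one_le₀ (by linarith [norm_nonneg G])
  have h1 : ‖t • G‖ ≤ 1 := by
    rw [norm_smul, Real.norm_of_nonneg ht0.le, ht, inv_mul_le_iff₀ hp]; linarith
  refine (csInf_le (errSet_bdd F) ⟨t • G, (1 - t) • 1, h1, ?_, rfl⟩).trans_lt ?_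
  · convert h.smul' t using 1
    rw [smul_mul_assoc, sub_smul, smul_sub, one_smul]; abel
  · rw [norm_smul, Real.norm_of_nonneg (by linarith)]
    have : ‖(1 : H →L[ℂ] H)‖ ≤ 1 := ContinuousLinearMap.norm_id_le
    nlinarith

lemma defect_eq_zero (F : H →L[ℂ] H) (hF : ‖F‖ ≤ 1) (h : Cpt (1 - F ^ 2)) : defect F = 0 := by
  refine le_antisymm ?_ (defect_nonneg F)
  exact csInf_le (errSet_bdd F) ⟨F, 0, hF, by simpa [sq] using h, by simp⟩

/-- The key lemma: functions supported strictly inside the essential gap give compact operators. -/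
lemma cpt_cfc (F : H →L[ℂ] H) (hF : IsSelfAdjoint F) (s : ℝ) (hs0 : 0 ≤ s) (hs : s < 1 - defect F)
    (g : ℝ → ℝ) (hg : Continuous g) (hgs : ∀ x, s ≤ |x| → g x = 0) : Cpt (cfc g F) := by
  obtain ⟨y, ⟨G, E, hG, hK, rfl⟩, hE⟩ := exists_lt_of_csInf_lt (errSet_ne F)
    (show sInf (errSet F) < 1 - s by change defect F < _; linarith)
  set F1 := cfc (fun x : ℝ ↦ max (-s) (min s x)) F with hF1
  have hn : ‖F1‖ ≤ s := norm_cfc_le hs0 fun x _ ↦ by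
    rw [Real.norm_eq_abs, abs_le]
    exact ⟨le_max_left _ _, max_le (by linarith) (min_le_left _ _)⟩
  have hmul : F1 * cfc g F = F * cfc g F := by
    conv_rhs => enter [1]; rw [← cfc_id' ℝ F]
    rw [hF1, ← cfc_mul _ _ F, ← cfc_mul _ _ F]
    refine cfc_congr fun x _ ↦ ?_
    by_cases hx : s ≤ |x|
    · simp [hgs x hx]
    · have := abs_lt.1 (not_le.1 hx)
      rw [min_eq_right this.2.le, max_eq_right this.1.le]
  have hlt : ‖G * F1 + E‖ < 1 := by
    have h1 := norm_add_le (G * F1) E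
    have h2 := norm_mul_le G F1
    have h3 : ‖G‖ * ‖F1‖ ≤ ‖F1‖ := mul_le_of_le_one_left (norm_nonneg _) hG
    linarith
  set u := Units.oneSub _ hlt with hu
  have e : (u : H →L[ℂ] H) * cfc g F = (1 - G * F - E) * cfc g F := by
    rw [hu, Units.val_oneSub]
    simp only [sub_mul, add_mul, mul_assoc, hmul]
    abel
  have e2 : cfc g F = (↑u⁻¹ : H →L[ℂ] H) * ((1 - G * F - E) * cfc g F) := by
    rw [← e, Units.inv_mul_cancel_left]
  rw [e2]
  exact (hK.mul_right _).mul_left _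

/-- Clamp to `[-1,1]`. -/
noncomputable def clamp (x : ℝ) : ℝ := max (-1) (min 1 x)

lemma clamp_cont : Continuous clamp := by unfold clamp; fun_prop

lemma clamp_abs (x : ℝ) : |clamp x| ≤ 1 :=
  abs_le.2 ⟨le_max_left _ _, max_le (by norm_num) (min_le_left _ _)⟩

lemma clamp_of (x : ℝ) (h : |x| ≤ 1) : clamp x = x := by
  have := abs_le.1 h
  rw [clamp, min_eq_right this.2, max_eq_right this.1]

lemma clamp_sq (x : ℝ) (h : 1 ≤ |x|) : clamp x ^ 2 = 1 := by
  rcases le_abs'.1 h with h | h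
  · rw [clamp, min_eq_right (by linarith), max_eq_left h]; norm_num
  · rw [clamp, min_eq_left h]; norm_num

/-- For `0 < s ≤ d ≤ 1`, the homotopy function is at least `s` in modulus outside `[-s,s]`. -/
lemma homotopy_bound (t d s x : ℝ) (ht0 : 0 ≤ t) (ht1 : t ≤ 1) (hs : 0 < s) (hsd : s ≤ d)
    (hd : d ≤ 1) (hx : s ≤ |x|) : s ^ 2 ≤ ((1 - t) * x + t * clamp (d⁻¹ * x)) ^ 2 := by
  have hd0 : 0 < d := hs.trans_le hsd
  have hs1 : s ≤ 1 := hsd.trans hd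
  have hi : 1 ≤ d⁻¹ := (one_le_inv₀ hd0).2 hd
  rcases le_abs'.1 hx with h | h
  · have hc : clamp (d⁻¹ * x) ≤ -s := by
      refine max_le (by linarith) ((min_le_right _ _).trans ?_)
      nlinarith
    have hle : (1 - t) * x + t * clamp (d⁻¹ * x) ≤ -s := by nlinarith
    nlinarith
  · have hc : s ≤ clamp (d⁻¹ * x) := by
      refine le_max_of_le_right (le_min hs1 ?_)
      nlinarith
    have hle : s ≤ (1 - t) * x + t * clamp (d⁻¹ * x) := by nlinarith
    nlinarith

/-- The homotopy. -/
noncomputable def htpy (p : ℝ × (H →L[ℂ] H)) : H →L[ℂ] H :=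
  (1 - p.1) • p.2 + p.1 • cfc clamp ((1 - defect p.2)⁻¹ • p.2)

lemma clampOp_cont {X : Type*} [TopologicalSpace X] {a : X → (H →L[ℂ] H)} {t : Set X}
    (ha : ContinuousOn a t) (hsa : ∀ x ∈ t, IsSelfAdjoint (a x)) :
    ContinuousOn (fun x ↦ cfc clamp (a x)) t :=
  ContinuousOn.cfc_of_mem_nhdsSet (s := Set.univ) clamp Filter.univ_mem ha hsa
    clamp_cont.continuousOn

lemma htpy_eq (t : ℝ) (F : H →L[ℂ] H) (hF : IsSelfAdjoint F) :
    htpy (t, F) = cfc (fun x : ℝ ↦ (1 - t) * x + t * clamp ((1 - defect F)⁻¹ * x)) F := by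
  have hc := clamp_cont
  rw [cfc_add (a := F) (fun x : ℝ ↦ (1 - t) * x) (fun x ↦ t * clamp ((1 - defect F)⁻¹ * x))
      (by fun_prop) (by fun_prop),
    cfc_const_mul (1 - t) (fun x : ℝ ↦ x) F, cfc_const_mul t _ F (by fun_prop), cfc_id' ℝ F, htpy,
    ← cfc_comp_smul _ clamp F (by fun_prop)]
  rfl

lemma htpy_mem (t : ℝ) (ht0 : 0 ≤ t) (ht1 : t ≤ 1) (F : H →L[ℂ] H) (hF : IsSelfAdjoint F)
    (hd : defect F < 1) : IsSelfAdjoint (htpy (t, F)) ∧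
      ∃ G : H →L[ℂ] H, Cpt (1 - G * htpy (t, F)) ∧ Cpt (1 - htpy (t, F) * G) := by
  have hc := clamp_cont
  have h0 := defect_nonneg F
  rw [htpy_eq t F hF]
  set d := 1 - defect F with hdd
  set f : ℝ → ℝ := fun x : ℝ ↦ (1 - t) * x + t * clamp (d⁻¹ * x) with hf
  have hfc : Continuous f := by fun_prop
  have hd0 : 0 < d := by linarith
  set h : ℝ → ℝ := fun x ↦ f x / max (f x ^ 2) ((d / 2) ^ 2) with hh
  have hpos : ∀ x, 0 < max (f x ^ 2) ((d / 2) ^ 2) := fun x ↦ lt_max_of_lt_right (by positivity)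
  have hhc : Continuous h := by
    refine hfc.div (by fun_prop) fun x ↦ (hpos x).ne'
  have key : Cpt (cfc (fun x ↦ 1 - h x * f x) F) := by
    refine cpt_cfc F hF (d / 2) (by linarith) (by linarith) _ (by fun_prop) fun x hx ↦ ?_
    have := homotopy_bound t d (d / 2) x ht0 ht1 (by linarith) (by linarith) (by linarith) hx
    have hm : max (f x ^ 2) ((d / 2) ^ 2) = f x ^ 2 := max_eq_left this
    have hp := hpos x
    rw [hm] at hp
    have hx1 : h x * f x = 1 := by
      rw [hh]
      change f x / max (f x ^ 2) ((d / 2) ^ 2) * f x = 1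
      rw [hm, div_mul_eq_mul_div, ← sq, div_self hp.ne']
    rw [hx1, sub_self]
  have e : cfc (fun x ↦ 1 - h x * f x) F = 1 - cfc h F * cfc f F := by
    rw [cfc_sub (a := F) (fun _ ↦ (1 : ℝ)) (fun x ↦ h x * f x) (by fun_prop) (by fun_prop),
      cfc_const_one ℝ F, cfc_mul h f F (by fun_prop) (by fun_prop)]
  refine ⟨cfc_predicate f F, cfc h F, e ▸ key, ?_⟩
  rw [(cfc_commute_cfc f h F).eq]
  exact e ▸ key

lemma htpy_one (F : H →L[ℂ] H) (hF : IsSelfAdjoint F)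
    (hd : defect F < 1) : ‖htpy (1, F)‖ ≤ 1 ∧ Cpt (1 - htpy (1, F) ^ 2) := by
  have hc := clamp_cont
  have h0 := defect_nonneg F
  have e : htpy (1, F) = cfc clamp ((1 - defect F)⁻¹ • F) := by simp [htpy]
  rw [e]
  refine ⟨norm_cfc_le zero_le_one fun x _ ↦ clamp_abs x, ?_⟩
  set d := 1 - defect F with hdd
  have hd0 : 0 < d := by linarith
  have hcont : ContinuousOn (fun s : ℝ ↦ 1 - (cfc clamp (s⁻¹ • F)) ^ 2) (Set.Ioi 0) := by
    refine continuousOn_const.sub (ContinuousOn.pow (clampOp_cont ?_ ?_) 2)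
    · exact (continuousOn_id.inv₀ fun x hx ↦ (ne_of_gt hx)).smul continuousOn_const
    · intro x _
      exact (IsSelfAdjoint.all (x⁻¹ : ℝ)).smul hF
  have ht : Tendsto (fun s : ℝ ↦ 1 - (cfc clamp (s⁻¹ • F)) ^ 2) (𝓝[<] d)
      (𝓝 (1 - (cfc clamp (d⁻¹ • F)) ^ 2)) :=
    ((hcont.continuousAt (Ioi_mem_nhds hd0)).tendsto).mono_left nhdsWithin_le_nhds
  refine cpt_closed.mem_of_tendsto ht ?_
  have hev : ∀ᶠ s in 𝓝[<] d, 0 < s := nhdsWithin_le_nhds (Ioi_mem_nhds hd0)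
  filter_upwards [hev, self_mem_nhdsWithin] with s hs hsd
  have hsd' : s < d := hsd
  have key : Cpt (cfc (fun x ↦ 1 - clamp (s⁻¹ * x) ^ 2) F) := by
    refine cpt_cfc F hF s hs.le hsd' _ (by fun_prop) fun x hx ↦ ?_
    rw [clamp_sq, sub_self]
    rw [abs_mul, abs_of_pos (inv_pos.2 hs), ← div_eq_inv_mul, le_div_iff₀ hs]
    linarith
  have e2 : cfc (fun x ↦ 1 - clamp (s⁻¹ * x) ^ 2) F = 1 - (cfc clamp (s⁻¹ • F)) ^ 2 := by
    rw [cfc_sub (a := F) (fun _ ↦ (1 : ℝ)) (fun x ↦ clamp (s⁻¹ * x) ^ 2) (by fun_prop)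
      (by fun_prop), cfc_const_one ℝ F, cfc_pow _ 2 F (by fun_prop),
      ← cfc_comp_smul _ clamp F (by fun_prop)]
    rfl
  exact e2 ▸ key

lemma htpy_fix (F : H →L[ℂ] H) (hF : IsSelfAdjoint F) (hn : ‖F‖ ≤ 1)
    (h : Cpt (1 - F ^ 2)) : htpy (1, F) = F := by
  have e : htpy (1, F) = cfc clamp F := by simp [htpy, defect_eq_zero F hn h]
  rw [e]
  conv_rhs => rw [← cfc_id' ℝ F]
  refine cfc_congr fun x hx ↦ clamp_of x ?_
  have h1 := spectrum.norm_le_norm_mul_of_mem hx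
  have : ‖(1 : H →L[ℂ] H)‖ ≤ 1 := ContinuousLinearMap.norm_id_le
  rw [← Real.norm_eq_abs]
  nlinarith [norm_nonneg F]

end Helpers

theorem deformation_retract_of_fredholms
    (H : Type*) [NormedAddCommGroup H] [InnerProductSpace ℂ H] [CompleteSpace H] :
    ∀ (Fstar FstarPM : Set (H →L[ℂ] H)),
      Fstar = {F | IsSelfAdjoint F ∧
        ∃ G : H →L[ℂ] H, IsCompactOperator ((1 - G * F : H →L[ℂ] H) : H → H) ∧
          IsCompactOperator ((1 - F * G : H →L[ℂ] H) : H → H)} →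
      FstarPM = {F ∈ Fstar | ‖F‖ ≤ 1 ∧
        IsCompactOperator ((1 - F ^ 2 : H →L[ℂ] H) : H → H)} →
      ∃ r : ℝ × (H →L[ℂ] H) → (H →L[ℂ] H),
        ContinuousOn r (Set.Icc (0:ℝ) 1 ×ˢ Fstar) ∧
        (∀ t ∈ Set.Icc (0:ℝ) 1, ∀ F ∈ Fstar, r (t, F) ∈ Fstar) ∧
        (∀ F ∈ Fstar, r (0, F) = F) ∧
        (∀ F ∈ Fstar, r (1, F) ∈ FstarPM) ∧
        (∀ F ∈ FstarPM, r (1, F) = F) := by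
  intro Fstar FstarPM h1 h2
  have hd : ∀ F ∈ Fstar, defect F < 1 := by
    intro F hF
    rw [h1] at hF
    obtain ⟨-, G, hG, -⟩ := hF
    exact defect_lt_one F G hG
  have hsa : ∀ F ∈ Fstar, IsSelfAdjoint F := by
    intro F hF
    rw [h1] at hF
    exact hF.1
  have hmem : ∀ t ∈ Set.Icc (0:ℝ) 1, ∀ F ∈ Fstar, htpy (t, F) ∈ Fstar := by
    intro t ht F hF
    have := htpy_mem t ht.1 ht.2 F (hsa F hF) (hd F hF)
    rw [h1]
    exact this
  refine ⟨htpy, ?_, hmem, ?_, ?_, ?_⟩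
  · have hdc : Continuous (defect : (H →L[ℂ] H) → ℝ) := defect_cont
    have hd2 : Continuous (fun p : ℝ × (H →L[ℂ] H) ↦ 1 - defect p.2) := by fun_prop
    unfold htpy
    refine ContinuousOn.add (Continuous.continuousOn (by fun_prop)) (continuousOn_fst.smul (clampOp_cont ?_ ?_))
    · refine ContinuousOn.smul (ContinuousOn.inv₀ hd2.continuousOn ?_) continuousOn_snd
      intro p hp
      have := hd p.2 hp.2
      linarith
    · intro p hp
      exact (IsSelfAdjoint.all ((1 - defect p.2)⁻¹ : ℝ)).smul (hsa p.2 hp.2)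
  · intro F _
    simp [htpy]
  · intro F hF
    rw [h2]
    exact ⟨hmem 1 (by simp) F hF, htpy_one F (hsa F hF) (hd F hF)⟩
  · intro F hF
    rw [h2] at hF
    exact htpy_fix F (hsa F hF.1) hF.2.1 hF.2.2
end

section
/- Let H be a complex Hilbert space and let ϑ(x) = x·(1+x²)^{−1/2}. There exists a constant C ≥ 0 such that for all self-adjoint A, B ∈ B(H), ‖ϑ(A) − ϑ(B)‖ ≤ C·‖A − B‖, where ϑ(A) and ϑ(B) are defined by continuous functional calculus. -/
theorem vartheta_aux_sylvester {E : Type*} [NormedRing E] [NormedAlgebra ℝ E]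
    (R S X : E) (c : ℝ) (hR : ‖algebraMap ℝ E c - R‖ ≤ c - 1)
    (hS : ‖algebraMap ℝ E c - S‖ ≤ c - 1) : 2 * ‖X‖ ≤ ‖R * X + X * S‖ := by
  have hid : (2 * c) • X = (R * X + X * S) + (algebraMap ℝ E c - R) * X
      + X * (algebraMap ℝ E c - S) := by
    simp only [sub_mul, mul_sub, Algebra.algebraMap_eq_smul_one, smul_mul_assoc, mul_smul_comm,
      one_mul, mul_one, two_mul, add_smul]
    abel
  have hc : 1 ≤ c := by linarith [norm_nonneg (algebraMap ℝ E c - R)]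
  have h0 : ‖(2 * c) • X‖ = 2 * c * ‖X‖ := by
    rw [norm_smul, Real.norm_of_nonneg (by linarith)]
  have h1 : ‖(2 * c) • X‖ ≤ ‖R * X + X * S‖ + (c - 1) * ‖X‖ + ‖X‖ * (c - 1) := by
    rw [hid]
    refine (norm_add₃_le).trans ?_
    gcongr
    · exact (norm_mul_le _ _).trans (by gcongr)
    · exact (norm_mul_le _ _).trans (by gcongr)
  rw [h0] at h1
  nlinarith

theorem vartheta_aux_data {H : Type*} [NormedAddCommGroup H] [InnerProductSpace ℂ H]
    [CompleteSpace H] (A : H →L[ℂ] H) (hA : IsSelfAdjoint A) (c : ℝ)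
    (hc : √(1 + (‖A‖ * ‖(1 : H →L[ℂ] H)‖) ^ 2) ≤ c) :
    ∃ U R : H →L[ℂ] H, star U * U = 1 ∧ U * star U = 1 ∧ IsSelfAdjoint R ∧
      U * R = A + Complex.I • (1 : H →L[ℂ] H) ∧ ‖algebraMap ℝ (H →L[ℂ] H) c - R‖ ≤ c - 1 ∧
      U + star U = (2 : ℂ) • cfc (fun x : ℝ => x / Real.sqrt (1 + x ^ 2)) A := by
  have hpos : ∀ x : ℝ, 0 < √(1 + x ^ 2) := fun x => by positivity
  have hne : ∀ x : ℝ, √(1 + x ^ 2) ≠ 0 := fun x => (hpos x).ne'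
  have hsq : ∀ x : ℝ, √(1 + x ^ 2) ^ 2 = 1 + x ^ 2 := fun x => Real.sq_sqrt (by positivity)
  have cP : Continuous (fun x : ℝ => x / √(1 + x ^ 2)) := by fun_prop (disch := exact hne _)
  have cQ : Continuous (fun x : ℝ => 1 / √(1 + x ^ 2)) := by fun_prop (disch := exact hne _)
  have cR : Continuous (fun x : ℝ => √(1 + x ^ 2)) := by fun_prop
  set P := cfc (fun x : ℝ => x / √(1 + x ^ 2)) A with hP
  set Q := cfc (fun x : ℝ => 1 / √(1 + x ^ 2)) A with hQ
  set R := cfc (fun x : ℝ => √(1 + x ^ 2)) A with hR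
  have sP : star P = P := (cfc_predicate _ A : IsSelfAdjoint P)
  have sQ : star Q = Q := (cfc_predicate _ A : IsSelfAdjoint Q)
  have sR : IsSelfAdjoint R := cfc_predicate _ A
  have hPQ : P * Q = Q * P := (cfc_commute_cfc _ _ A).eq
  have hone : P * P + Q * Q = 1 := by
    rw [hP, hQ, ← cfc_mul _ _ A cP.continuousOn cP.continuousOn,
      ← cfc_mul _ _ A cQ.continuousOn cQ.continuousOn,
      ← cfc_add A (fun x : ℝ => x / √(1 + x ^ 2) * (x / √(1 + x ^ 2)))
        (fun x : ℝ => 1 / √(1 + x ^ 2) * (1 / √(1 + x ^ 2)))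
        (cP.mul cP).continuousOn (cQ.mul cQ).continuousOn, ← cfc_one ℝ A]
    refine cfc_congr fun x _ => ?_
    have := hne x
    have := hsq x
    simp only [Pi.one_apply]
    field_simp
    linarith
  have hPR : P * R = A := by
    rw [hP, hR, ← cfc_mul _ _ A cP.continuousOn cR.continuousOn]
    conv_rhs => rw [← cfc_id' ℝ A]
    refine cfc_congr fun x _ => ?_
    exact div_mul_cancel₀ _ (hne x)
  have hQR : Q * R = 1 := by
    rw [hQ, hR, ← cfc_mul _ _ A cQ.continuousOn cR.continuousOn, ← cfc_one ℝ A]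
    refine cfc_congr fun x _ => ?_
    exact div_mul_cancel₀ _ (hne x)
  have sU : star (P + Complex.I • Q) = P - Complex.I • Q := by
    simp [star_add, star_smul, sP, sQ, sub_eq_add_neg]
  refine ⟨P + Complex.I • Q, R, ?_, ?_, sR, ?_, ?_, ?_⟩
  · rw [sU, ← hone]
    simp only [sub_mul, mul_add, smul_sub, smul_mul_assoc, mul_smul_comm, smul_smul, Complex.I_mul_I, hPQ,
      neg_smul, one_smul]
    abel
  · rw [sU, ← hone]
    simp only [mul_sub, add_mul, smul_add, smul_mul_assoc, mul_smul_comm, smul_smul, Complex.I_mul_I, hPQ,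
      neg_smul, one_smul]
    abel
  · rw [add_mul, smul_mul_assoc, hPR, hQR]
  · have : algebraMap ℝ (H →L[ℂ] H) c - R = cfc (fun x : ℝ => c - √(1 + x ^ 2)) A := by
      rw [cfc_sub _ _ A continuousOn_const cR.continuousOn, cfc_const c A]
    rw [this]
    have h1 : ∀ x : ℝ, 1 ≤ √(1 + x ^ 2) := fun x =>
      Real.one_le_sqrt.mpr (by nlinarith [sq_nonneg x])
    refine norm_cfc_le (by linarith [h1 (‖A‖ * ‖(1 : H →L[ℂ] H)‖)]) fun x hx => ?_
    have hx' := spectrum.norm_le_norm_mul_of_mem hx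
    have h2 : √(1 + x ^ 2) ≤ c := by
      refine le_trans (Real.sqrt_le_sqrt ?_) hc
      have : x ^ 2 ≤ (‖A‖ * ‖(1 : H →L[ℂ] H)‖) ^ 2 := by
        rw [← sq_abs x]
        exact pow_le_pow_left₀ (abs_nonneg _) hx' 2
      linarith
    rw [Real.norm_of_nonneg (by linarith)]
    linarith [h1 x]
  · rw [sU, two_smul]
    abel

theorem vartheta_lipschitz_in_operator_norm
    (H : Type*) [NormedAddCommGroup H] [InnerProductSpace ℂ H] [CompleteSpace H] :
    ∃ C : ℝ, 0 ≤ C ∧ ∀ A B : H →L[ℂ] H, IsSelfAdjoint A → IsSelfAdjoint B →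
      ‖cfc (fun x : ℝ => x / Real.sqrt (1 + x ^ 2)) A -
        cfc (fun x : ℝ => x / Real.sqrt (1 + x ^ 2)) B‖ ≤ C * ‖A - B‖ := by
  refine ⟨1, zero_le_one, fun A B hA hB => ?_⟩
  obtain ⟨U, R, hU, hU', sR, hUR, hRc, hUP⟩ := vartheta_aux_data A hA _ (le_max_left _ _)
  obtain ⟨V, S, hV, hV', sS, hVS, hSc, hVP⟩ := vartheta_aux_data B hB _ (le_max_right _ _)
  have hn : ∀ W : H →L[ℂ] H, star W * W = 1 → ‖W‖ ≤ 1 := fun W hW => by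
    have h1 : ‖W‖ * ‖W‖ ≤ 1 := by
      rw [← CStarRing.norm_star_mul_self, hW]
      exact ContinuousLinearMap.norm_id_le
    nlinarith [norm_nonneg W]
  have hD : A - B = U * R - V * S := by rw [hUR, hVS]; abel
  have hD' : A - B = R * star U - S * star V := by
    rw [← (hA.sub hB).star_eq, hD, star_sub, star_mul, star_mul, sR.star_eq, sS.star_eq]
  have hY : R * (1 - star U * V) + (1 - star U * V) * S
      = star U * (A - B) - (A - B) * V := by
    nth_rewrite 1 [hD]
    rw [hD']
    have e1 : star U * (U * R) = R := by rw [← mul_assoc, hU, one_mul]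
    have e2 : S * star V * V = S := by rw [mul_assoc, hV, mul_one]
    rw [mul_sub, sub_mul, mul_sub, sub_mul, e1, e2]
    simp only [mul_one, one_mul, mul_assoc]
    abel
  have hX := vartheta_aux_sylvester R S (1 - star U * V) _ hRc hSc
  have hYn : ‖star U * (A - B) - (A - B) * V‖ ≤ 2 * ‖A - B‖ := by
    refine (norm_sub_le _ _).trans ?_
    have h1 := norm_mul_le (star U) (A - B)
    have h2 := norm_mul_le (A - B) V
    rw [norm_star] at h1
    nlinarith [hn U hU, hn V hV, norm_nonneg (A - B)]
  rw [hY] at hX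
  have hUV : ‖U - V‖ ≤ ‖A - B‖ := by
    have : U - V = U * (1 - star U * V) := by rw [mul_sub, ← mul_assoc, hU', one_mul, mul_one]
    rw [this]
    have h1 := norm_mul_le U (1 - star U * V)
    nlinarith [hn U hU, norm_nonneg (1 - star U * V)]
  have h2 : (2 : ℂ) • (cfc (fun x : ℝ => x / Real.sqrt (1 + x ^ 2)) A -
        cfc (fun x : ℝ => x / Real.sqrt (1 + x ^ 2)) B) = (U - V) + star (U - V) := by
    rw [smul_sub, ← hUP, ← hVP, star_sub]; abel
  have h3 := congrArg norm h2
  rw [norm_smul, Complex.norm_ofNat] at h3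
  have h4 := norm_add_le (U - V) (star (U - V))
  rw [norm_star] at h4
  linarith
end

section
/- Let H be a complex Hilbert space and let f : ℝ → ℝ be twice continuously differentiable with compact support. Then there exists a constant C ≥ 0 such that for all self-adjoint A, B ∈ B(H), ‖f(A) − f(B)‖ ≤ C·‖A − B‖, where f(A) and f(B) are defined by continuous functional calculus. In particular, every compactly supported C² function maps operator-norm continuous paths of self-adjoint bounded operators to operator-norm continuous paths. -/
noncomputable def uu (n : ℤ) (x : ℝ) : ℂ := Complex.exp ((n * (2 * Real.arctan x) : ℝ) * Complex.I)

lemma uu_cont (n : ℤ) : Continuous (uu n) := by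
  unfold uu; have := Real.continuous_arctan; fun_prop

lemma uu_norm (n : ℤ) (x : ℝ) : ‖uu n x‖ = 1 := by
  unfold uu; exact Complex.norm_exp_ofReal_mul_I _

lemma uu_add (m n : ℤ) (x : ℝ) : uu (m + n) x = uu m x * uu n x := by
  unfold uu; rw [← Complex.exp_add]; congr 1; push_cast; ring

lemma uu_neg (n : ℤ) (x : ℝ) : uu (-n) x = star (uu n x) := by
  unfold uu
  rw [Complex.star_def, ← Complex.exp_conj]; congr 1
  rw [map_mul, Complex.conj_ofReal, Complex.conj_I]; push_cast; ring

lemma den_ne (x : ℝ) : (1 - Complex.I * x : ℂ) ≠ 0 := by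
  intro h; have := congrArg Complex.re h; simp at this

lemma uu_one (x : ℝ) : uu 1 x = 2 * (1 - Complex.I * x)⁻¹ - 1 := by
  have h1 : uu 1 x = (Complex.exp ((Real.arctan x : ℝ) * Complex.I)) ^ 2 := by
    unfold uu; rw [← Complex.exp_nat_mul]; congr 1; push_cast; ring
  have hs : (√(1 + x ^ 2)) ≠ 0 := by positivity
  have hs2 : (√(1 + x ^ 2)) ^ 2 = 1 + x ^ 2 := Real.sq_sqrt (by positivity)
  have hs2' : ((√(1 + x ^ 2) : ℝ) : ℂ) ^ 2 = 1 + x ^ 2 := by exact_mod_cast hs2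
  have h0 : (1 + (x:ℂ) ^ 2) ≠ 0 := by rw [← hs2']; exact_mod_cast pow_ne_zero 2 hs
  have hd := den_ne x
  rw [h1, Complex.exp_mul_I, ← Complex.ofReal_cos, ← Complex.ofReal_sin, Real.cos_arctan,
    Real.sin_arctan]
  have : (((1 / √(1 + x ^ 2) : ℝ) : ℂ) + ((x / √(1 + x ^ 2) : ℝ) : ℂ) * Complex.I) ^ 2
     = (1 + x * Complex.I) ^ 2 / (1 + x ^ 2) := by
    rw [← hs2']; push_cast; have : ((√(1 + x ^ 2) : ℝ) : ℂ) ≠ 0 := by exact_mod_cast hs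
    field_simp
  have h3 : (1 - Complex.I * x : ℂ)⁻¹ = (1 + x * Complex.I) / (1 + x ^ 2) := by
    rw [inv_eq_iff_eq_inv, inv_div, eq_div_iff]
    · linear_combination (-(x : ℂ) ^ 2) * Complex.I_sq
    · intro h; have := congrArg Complex.re h; simp at this
  rw [this, h3]
  field_simp
  linear_combination ((x : ℂ) ^ 2) * Complex.I_sq

lemma inv_norm (x : ℝ) : ‖(1 - Complex.I * x : ℂ)⁻¹‖ ≤ 1 := by
  rw [norm_inv]
  apply inv_le_one_of_one_le₀
  have := Complex.abs_re_le_norm (1 - Complex.I * x : ℂ)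
  simpa using this

section ops
variable {H : Type*} [NormedAddCommGroup H] [InnerProductSpace ℂ H] [CompleteSpace H]

noncomputable def Phi (φ : ℝ → ℂ) (A : H →L[ℂ] H) : H →L[ℂ] H := cfc (fun z : ℂ => φ z.re) A

lemma Phi_norm {φ : ℝ → ℂ} {c : ℝ} (hc : 0 ≤ c) (h : ∀ x, ‖φ x‖ ≤ c) (A : H →L[ℂ] H) :
    ‖Phi φ A‖ ≤ c := norm_cfc_le hc (fun _ _ => h _)

lemma cont_re {φ : ℝ → ℂ} (hφ : Continuous φ) (s : Set ℂ) : ContinuousOn (fun z : ℂ => φ z.re) s :=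
  (hφ.comp Complex.continuous_re).continuousOn

lemma Phi_mul {φ ψ : ℝ → ℂ} (hφ : Continuous φ) (hψ : Continuous ψ) (A : H →L[ℂ] H) :
    Phi (fun x => φ x * ψ x) A = Phi φ A * Phi ψ A :=
  cfc_mul _ _ A (cont_re hφ _) (cont_re hψ _)

lemma Phi_sub {φ ψ : ℝ → ℂ} (hφ : Continuous φ) (hψ : Continuous ψ) (A : H →L[ℂ] H) :
    Phi (fun x => φ x - ψ x) A = Phi φ A - Phi ψ A :=
  cfc_sub _ _ A (cont_re hφ _) (cont_re hψ _)

lemma Phi_cmul (c : ℂ) {φ : ℝ → ℂ} (hφ : Continuous φ) (A : H →L[ℂ] H) :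
    Phi (fun x => c * φ x) A = c • Phi φ A :=
  cfc_const_mul c _ A (cont_re hφ _)

lemma Phi_star (φ : ℝ → ℂ) (A : H →L[ℂ] H) : Phi (fun x => star (φ x)) A = star (Phi φ A) :=
  cfc_star _ A

lemma Phi_sum (S : Finset ℤ) (φ : ℤ → ℝ → ℂ) (hφ : ∀ n, Continuous (φ n)) (A : H →L[ℂ] H) :
    Phi (fun x => ∑ n ∈ S, φ n x) A = ∑ n ∈ S, Phi (φ n) A := by
  unfold Phi
  rw [← cfc_sum _ A S (fun i _ => cont_re (hφ i) _)]
  congr 1; ext z; simp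

lemma Phi_one {A : H →L[ℂ] H} (hA : IsSelfAdjoint A) : Phi (fun _ => 1) A = 1 :=
  cfc_const_one ℂ A hA.isStarNormal

lemma Phi_id {A : H →L[ℂ] H} (hA : IsSelfAdjoint A) : Phi (fun x => (x : ℂ)) A = A := by
  unfold Phi
  rw [← cfc_real_eq_complex (fun x => x) hA, cfc_id' ℝ A hA]

lemma res_lip {A B : H →L[ℂ] H} (hA : IsSelfAdjoint A) (hB : IsSelfAdjoint B) :
    ‖Phi (fun x => (1 - Complex.I * x : ℂ)⁻¹) A - Phi (fun x => (1 - Complex.I * x : ℂ)⁻¹) B‖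
      ≤ ‖A - B‖ := by
  have hc : Continuous (fun x : ℝ => (1 - Complex.I * x : ℂ)⁻¹) :=
    Continuous.inv₀ (by fun_prop) den_ne
  have hd : Continuous (fun x : ℝ => (1 - Complex.I * x : ℂ)) := by fun_prop
  have key : ∀ {A : H →L[ℂ] H}, IsSelfAdjoint A →
      Phi (fun x => (1 - Complex.I * x : ℂ)) A = 1 - Complex.I • A := by
    intro A hA
    rw [Phi_sub (by fun_prop) (by fun_prop), Phi_one hA, Phi_cmul _ (by fun_prop), Phi_id hA]
  have l : Phi (fun x => (1 - Complex.I * x : ℂ)⁻¹) A * (1 - Complex.I • A) = 1 := by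
    rw [← key hA, ← Phi_mul hc hd, ← Phi_one hA]
    congr 1; ext x; exact inv_mul_cancel₀ (den_ne x)
  have r : (1 - Complex.I • B) * Phi (fun x => (1 - Complex.I * x : ℂ)⁻¹) B = 1 := by
    rw [← key hB, ← Phi_mul hd hc, ← Phi_one hB]
    congr 1; ext x; exact mul_inv_cancel₀ (den_ne x)
  have nA := Phi_norm zero_le_one inv_norm A
  have nB := Phi_norm zero_le_one inv_norm B
  set RA := Phi (fun x => (1 - Complex.I * x : ℂ)⁻¹) A
  set RB := Phi (fun x => (1 - Complex.I * x : ℂ)⁻¹) B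
  have : RA - RB = RA * (Complex.I • (A - B)) * RB := by
    calc RA - RB = RA * ((1 - Complex.I • B) * RB) - (RA * (1 - Complex.I • A)) * RB := by
          rw [l, r, mul_one, one_mul]
      _ = _ := by rw [smul_sub]; noncomm_ring
  rw [this]
  calc _ ≤ ‖RA‖ * ‖Complex.I • (A - B)‖ * ‖RB‖ :=
        (norm_mul_le _ _).trans (by gcongr; exact norm_mul_le _ _)
    _ ≤ 1 * ‖Complex.I • (A - B)‖ * 1 := by gcongr
    _ = _ := by rw [norm_smul]; simp

lemma uu_lip_nat {A B : H →L[ℂ] H} (hA : IsSelfAdjoint A) (hB : IsSelfAdjoint B) (n : ℕ) :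
    ‖Phi (uu n) A - Phi (uu n) B‖ ≤ n * (2 * ‖A - B‖) := by
  have h1 : ‖Phi (uu 1) A - Phi (uu 1) B‖ ≤ 2 * ‖A - B‖ := by
    have hc : Continuous (fun x : ℝ => (1 - Complex.I * x : ℂ)⁻¹) :=
      Continuous.inv₀ (by fun_prop) den_ne
    have e : uu 1 = fun x : ℝ => 2 * (1 - Complex.I * x : ℂ)⁻¹ - 1 := funext uu_one
    rw [e, Phi_sub (by fun_prop) (by fun_prop), Phi_sub (by fun_prop) (by fun_prop), Phi_one hA,
      Phi_one hB, Phi_cmul _ hc, Phi_cmul _ hc, sub_sub_sub_cancel_right, ← smul_sub, norm_smul]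
    simpa using res_lip hA hB
  induction n with
  | zero =>
    have e : uu ((0:ℕ):ℤ) = fun _ => 1 := by ext x; simp [uu]
    rw [e, Phi_one hA, Phi_one hB]; simp
  | succ k ih =>
    have e : uu ((k + 1 : ℕ) : ℤ) = fun x => uu k x * uu 1 x := by
      ext x; push_cast; exact uu_add _ _ _
    rw [e, Phi_mul (uu_cont _) (uu_cont _), Phi_mul (uu_cont _) (uu_cont _)]
    have n1 := Phi_norm zero_le_one (fun x => (uu_norm 1 x).le) B
    have n2 := Phi_norm zero_le_one (fun x => (uu_norm k x).le) A
    calc _ = ‖Phi (uu k) A * (Phi (uu 1) A - Phi (uu 1) B)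
              + (Phi (uu k) A - Phi (uu k) B) * Phi (uu 1) B‖ := by congr 1; noncomm_ring
      _ ≤ ‖Phi (uu k) A‖ * ‖Phi (uu 1) A - Phi (uu 1) B‖
              + ‖Phi (uu k) A - Phi (uu k) B‖ * ‖Phi (uu 1) B‖ :=
          (norm_add_le _ _).trans (add_le_add (norm_mul_le _ _) (norm_mul_le _ _))
      _ ≤ 1 * (2 * ‖A - B‖) + (k * (2 * ‖A - B‖)) * 1 := by gcongr
      _ = _ := by push_cast; ring

lemma uu_lip {A B : H →L[ℂ] H} (hA : IsSelfAdjoint A) (hB : IsSelfAdjoint B) (n : ℤ) :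
    ‖Phi (uu n) A - Phi (uu n) B‖ ≤ |(n : ℝ)| * (2 * ‖A - B‖) := by
  obtain ⟨k, rfl | rfl⟩ := n.eq_nat_or_neg
  · simpa using uu_lip_nat hA hB k
  · have e : uu (-(k:ℤ)) = fun x => star (uu k x) := funext (uu_neg _)
    rw [e, Phi_star, Phi_star, ← star_sub, norm_star]
    simpa using uu_lip_nat hA hB k

lemma cfc_lip_aux {f : ℝ → ℝ} (hf : Continuous f) (c : ℤ → ℂ)
    (hc : Summable (fun n : ℤ => |(n : ℝ)| * ‖c n‖))
    (happ : ∀ ε > 0, ∃ S : Finset ℤ, ∀ x : ℝ, ‖(f x : ℂ) - ∑ n ∈ S, c n * uu n x‖ ≤ ε)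
    {A B : H →L[ℂ] H} (hA : IsSelfAdjoint A) (hB : IsSelfAdjoint B) :
    ‖cfc f A - cfc f B‖ ≤ (2 * ∑' n : ℤ, |(n : ℝ)| * ‖c n‖) * ‖A - B‖ := by
  apply le_of_forall_pos_le_add
  intro ε hε
  obtain ⟨S, hS⟩ := happ (ε / 2) (by positivity)
  have hfc : Continuous (fun x => (f x : ℂ)) := by fun_prop
  have hcu : ∀ n, Continuous (fun x => c n * uu n x) := fun n => continuous_const.mul (uu_cont n)
  have e : ∀ {A : H →L[ℂ] H}, IsSelfAdjoint A → ‖cfc f A - ∑ n ∈ S, c n • Phi (uu n) A‖ ≤ ε / 2 := by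
    intro A hA
    have := Phi_norm (by positivity) hS A
    rw [Phi_sub hfc (continuous_finsetSum _ fun n _ => hcu n), Phi_sum _ _ hcu] at this
    simp_rw [Phi_cmul _ (uu_cont _)] at this
    rwa [cfc_real_eq_complex f hA]
  have m : ‖∑ n ∈ S, c n • Phi (uu n) A - ∑ n ∈ S, c n • Phi (uu n) B‖
      ≤ (2 * ∑' n : ℤ, |(n : ℝ)| * ‖c n‖) * ‖A - B‖ := by
    rw [← Finset.sum_sub_distrib]
    calc _ ≤ ∑ n ∈ S, ‖c n • Phi (uu n) A - c n • Phi (uu n) B‖ := norm_sum_le _ _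
      _ ≤ ∑ n ∈ S, (|(n : ℝ)| * ‖c n‖) * (2 * ‖A - B‖) := by
        gcongr with n hn
        rw [← smul_sub, norm_smul]
        nlinarith [uu_lip hA hB n, norm_nonneg (c n)]
      _ = (∑ n ∈ S, (|(n : ℝ)| * ‖c n‖)) * (2 * ‖A - B‖) := by rw [Finset.sum_mul]
      _ ≤ (∑' n : ℤ, |(n : ℝ)| * ‖c n‖) * (2 * ‖A - B‖) := by
        gcongr; exact hc.sum_le_tsum _ (fun _ _ => by positivity)
      _ = _ := by ring
  have eA := e hA
  have eB := e hB
  rw [norm_sub_rev] at eB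
  calc _ = ‖(cfc f A - ∑ n ∈ S, c n • Phi (uu n) A)
      + (∑ n ∈ S, c n • Phi (uu n) A - ∑ n ∈ S, c n • Phi (uu n) B)
      + (∑ n ∈ S, c n • Phi (uu n) B - cfc f B)‖ := by congr 1; abel
    _ ≤ _ := norm_add₃_le
    _ ≤ _ := by linarith
end ops

section four
open Real MeasureTheory Set Topology Filter

lemma coeff_summable {a b : ℝ} (hab : a < b) {G : ℝ → ℂ} (hG : ContDiff ℝ 2 G)
    (h0 : G a = G b) (h1 : deriv G a = deriv G b) :
    Summable (fun n : ℤ => |(n : ℝ)| * ‖fourierCoeffOn hab G n‖) := by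
  have hG1 : ContDiff ℝ 1 (deriv G) := by
    have : ContDiff ℝ (1 + 1) G := by simpa [one_add_one_eq_two] using hG
    exact (contDiff_succ_iff_deriv.1 this).2.2
  have c1 : Continuous (deriv G) := hG1.continuous
  have c2 : Continuous (deriv (deriv G)) := hG1.continuous_deriv le_rfl
  have d0 : ∀ x, HasDerivAt G (deriv G x) x := fun x =>
    (hG.differentiable (by norm_num) x).hasDerivAt
  have d1 : ∀ x, HasDerivAt (deriv G) (deriv (deriv G) x) x := fun x =>
    (hG1.differentiable (by norm_num) x).hasDerivAt
  have hL : MemLp (deriv (deriv G)) 2 (volume.restrict (Ioc a b)) := by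
    obtain ⟨C, hC⟩ := (isCompact_Icc (a := a) (b := b)).exists_bound_of_continuousOn c2.continuousOn
    refine MemLp.of_bound c2.aestronglyMeasurable C ?_
    filter_upwards [ae_restrict_mem measurableSet_Ioc] with x hx
    exact hC x (Ioc_subset_Icc_self hx)
  have hP := (hasSum_sq_fourierCoeffOn hab hL).summable
  have hZ : Summable (fun n : ℤ => 1 / (n : ℝ) ^ 2) := Real.summable_one_div_int_pow.2 one_lt_two
  refine Summable.of_nonneg_of_le (fun n => by positivity) (fun n => ?_)
    ((hP.add hZ).mul_left ((b - a) ^ 2))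
  rcases eq_or_ne n 0 with rfl | hn
  · simp; positivity
  rw [fourierCoeffOn_of_hasDerivAt hab hn (fun x _ => d0 x) (c1.intervalIntegrable _ _),
    fourierCoeffOn_of_hasDerivAt hab hn (fun x _ => d1 x) (c2.intervalIntegrable _ _), h0, h1]
  have hba : ‖(b : ℂ) - a‖ = b - a := by
    rw [← Complex.ofReal_sub, Complex.norm_real, Real.norm_of_nonneg (by linarith)]
  have hnn : ‖(n : ℂ)‖ = |(n : ℝ)| := by simp
  simp only [sub_self, mul_zero, zero_sub, norm_mul, norm_neg, norm_div, norm_one, hba, hnn,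
    Complex.norm_I, Complex.norm_real, Real.norm_of_nonneg pi_pos.le, Complex.norm_ofNat]
  set q := ‖fourierCoeffOn hab (deriv (deriv G)) n‖
  have hn' : 0 < |(n : ℝ)| := by positivity
  rw [← sq_abs (n : ℝ)]
  set m := |(n : ℝ)|
  have hq : 0 ≤ q := norm_nonneg _
  have e : m * (1 / (2 * π * 1 * m) * ((b - a) * (1 / (2 * π * 1 * m) * ((b - a) * q))))
      = (b - a) ^ 2 * ((1 / (2 * π)) ^ 2 * (q * (1 / m))) := by
    field_simp
  rw [e]
  have hp : (1 / (2 * π)) ^ 2 ≤ 1 := by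
    apply pow_le_one₀ (by positivity)
    rw [div_le_one (by positivity)]; linarith [pi_gt_three]
  gcongr
  have h2 : 0 ≤ q * (1 / m) := by positivity
  calc (1 / (2 * π)) ^ 2 * (q * (1 / m)) ≤ 1 * (q * (1 / m)) := by gcongr
    _ ≤ q ^ 2 + (1 / m) ^ 2 := by nlinarith [sq_nonneg (q - 1 / m)]
    _ = _ := by rw [div_pow, one_pow]

lemma exists_G {f : ℝ → ℝ} (hf : ContDiff ℝ 2 f) (hsupp : HasCompactSupport f) :
    ∃ G : ℝ → ℂ, ContDiff ℝ 2 G ∧ (∀ x, π ≤ |x| → G =ᶠ[𝓝 x] 0) ∧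
      ∀ x, G (2 * arctan x) = f x := by
  obtain ⟨R, hR⟩ : ∃ R : ℝ, ∀ x, f x ≠ 0 → |x| < R := by
    obtain ⟨R, hR⟩ := hsupp.isCompact.isBounded.exists_norm_le
    refine ⟨R + 1, fun x hx => ?_⟩
    have := hR x (subset_tsupport f hx)
    rw [Real.norm_eq_abs] at this; linarith
  let G : ℝ → ℂ := fun θ => if |θ| < π then (f (tan (θ / 2)) : ℂ) else 0
  have hz : ∀ x, π ≤ |x| → G =ᶠ[𝓝 x] 0 := by
    intro x hx
    have : ∀ᶠ y in 𝓝 x, 2 * arctan R < |y| := by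
      apply continuous_abs.continuousAt.eventually_const_lt
      linarith [arctan_lt_pi_div_two R]
    filter_upwards [this] with y hy
    simp only [G, Pi.zero_apply]
    split_ifs with h
    · by_contra hne
      have h1 := hR (tan (y / 2)) (by exact_mod_cast hne)
      rw [abs_lt] at h h1
      have h2 : arctan (tan (y / 2)) = y / 2 := arctan_tan (by linarith) (by linarith)
      have h3 := arctan_strictMono h1.1
      have h4 := arctan_strictMono h1.2
      rw [h2] at h3 h4
      rw [arctan_neg] at h3
      have : |y| < 2 * arctan R := abs_lt.2 ⟨by linarith, by linarith⟩
      linarith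
    · rfl
  refine ⟨G, ?_, hz, ?_⟩
  · rw [contDiff_iff_contDiffAt]
    intro x
    rcases le_or_gt π |x| with hx | hx
    · exact contDiffAt_const.congr_of_eventuallyEq (hz x hx)
    · have he : G =ᶠ[𝓝 x] fun θ => (f (tan (θ / 2)) : ℂ) := by
        filter_upwards [continuous_abs.continuousAt.eventually_lt_const hx] with y hy
        simp [G, hy]
      refine ContDiffAt.congr_of_eventuallyEq ?_ he
      rw [abs_lt] at hx
      have hc : cos (x / 2) ≠ 0 := (cos_pos_of_mem_Ioo ⟨by linarith, by linarith⟩).ne'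
      have ht : ContDiffAt ℝ 2 (fun θ : ℝ => Real.tan (θ / 2)) x :=
        ContDiffAt.comp (g := Real.tan) x (Real.contDiffAt_tan.2 hc)
          (contDiffAt_id.div_const (2 : ℝ))
      exact Complex.ofRealCLM.contDiff.contDiffAt.comp x (hf.contDiffAt.comp x ht)
  · intro x
    have h : |2 * arctan x| < π := abs_lt.2 ⟨by linarith [neg_pi_div_two_lt_arctan x],
      by linarith [arctan_lt_pi_div_two x]⟩
    simp only [G, h, if_true]
    rw [mul_div_cancel_left₀ _ two_ne_zero, tan_arctan]

lemma exists_approx {f : ℝ → ℝ} (hf : ContDiff ℝ 2 f) (hsupp : HasCompactSupport f) :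
    ∃ c : ℤ → ℂ, Summable (fun n : ℤ => |(n : ℝ)| * ‖c n‖) ∧
     ∀ ε > 0, ∃ S : Finset ℤ, ∀ x : ℝ, ‖(f x : ℂ) - ∑ n ∈ S, c n * 
       Complex.exp ((n * (2 * Real.arctan x) : ℝ) * Complex.I)‖ ≤ ε := by
  obtain ⟨G, hG, hz, hGf⟩ := exists_G hf hsupp
  have hT : Fact (0 < 2 * π) := ⟨two_pi_pos⟩
  have e : -π + 2 * π = π := by ring
  have z1 := hz π (le_abs_self _)
  have z2 := hz (-π) (by rw [abs_neg]; exact le_abs_self _)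
  have hend : G (-π) = G (-π + 2 * π) := by
    rw [e, z1.eq_of_nhds, z2.eq_of_nhds]; rfl
  have hend' : deriv G (-π) = deriv G (-π + 2 * π) := by
    rw [e, z1.deriv_eq, z2.deriv_eq]; simp
  have hs := coeff_summable (lt_add_of_pos_right (-π) hT.out) hG hend hend'
  let g : C(AddCircle (2 * π), ℂ) := ⟨AddCircle.liftIco (2 * π) (-π) G,
    AddCircle.liftIco_continuous hend hG.continuous.continuousOn⟩
  have hc : ∀ n, fourierCoeff g n = fourierCoeffOn (lt_add_of_pos_right (-π) hT.out) G n :=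
    fun n => fourierCoeff_liftIco_eq G n
  simp_rw [← hc] at hs
  refine ⟨fourierCoeff g, hs, fun ε hε => ?_⟩
  have hsum : Summable (fourierCoeff g) := by
    refine Summable.of_norm_bounded_eventually hs ?_
    have : ∀ᶠ n : ℤ in cofinite, n ≠ 0 := by
      rw [Filter.eventually_cofinite]
      exact (Set.finite_singleton (0 : ℤ)).subset (by intro n hn; simpa using hn)
    filter_upwards [this] with n hn
    have : (1 : ℝ) ≤ |(n : ℝ)| := by exact_mod_cast Int.one_le_abs hn
    nlinarith [norm_nonneg (fourierCoeff g n)]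
  have hh := hasSum_fourier_series_of_summable hsum
  obtain ⟨S, hS⟩ := ((Metric.tendsto_nhds.1 hh) ε hε).exists
  refine ⟨S, fun x => ?_⟩
  rw [dist_comm, dist_eq_norm] at hS
  have := (ContinuousMap.norm_coe_le_norm _ ((2 * arctan x : ℝ) : AddCircle (2 * π))).trans hS.le
  have hx : g ((2 * arctan x : ℝ) : AddCircle (2 * π)) = f x := by
    rw [← hGf]
    exact AddCircle.liftIco_coe_apply ⟨by linarith [neg_pi_div_two_lt_arctan x],
      by linarith [arctan_lt_pi_div_two x]⟩
  rw [ContinuousMap.sub_apply, hx, ContinuousMap.sum_apply] at this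
  refine le_of_eq_of_le ?_ this
  congr 2
  refine Finset.sum_congr rfl fun n _ => ?_
  rw [ContinuousMap.smul_apply, smul_eq_mul, fourier_coe_apply]
  congr 2
  have : (π : ℂ) ≠ 0 := by exact_mod_cast pi_ne_zero
  push_cast; field_simp

end four

theorem cfc_lipschitz_of_compactly_supported_C2
    (H : Type*) [NormedAddCommGroup H] [InnerProductSpace ℂ H] [CompleteSpace H]
    (f : ℝ → ℝ) (hf : ContDiff ℝ 2 f) (hsupp : HasCompactSupport f) :
    (∃ C : ℝ, 0 ≤ C ∧ ∀ A B : H →L[ℂ] H, IsSelfAdjoint A → IsSelfAdjoint B →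
        ‖cfc f A - cfc f B‖ ≤ C * ‖A - B‖) ∧
      ∀ D : ℝ → (H →L[ℂ] H), Continuous D → (∀ t, IsSelfAdjoint (D t)) →
        Continuous (fun t => cfc f (D t)) := by
  obtain ⟨c, hc, happ⟩ := exists_approx hf hsupp
  have key : ∃ C : ℝ, 0 ≤ C ∧ ∀ A B : H →L[ℂ] H, IsSelfAdjoint A → IsSelfAdjoint B →
        ‖cfc f A - cfc f B‖ ≤ C * ‖A - B‖ :=
    ⟨2 * ∑' n : ℤ, |(n : ℝ)| * ‖c n‖,
      mul_nonneg zero_le_two (tsum_nonneg fun n => mul_nonneg (abs_nonneg _) (norm_nonneg _)),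
      fun A B hA hB => cfc_lip_aux hf.continuous c hc happ hA hB⟩
  refine ⟨key, fun D hD hsa => ?_⟩
  obtain ⟨C, hC, h⟩ := key
  rw [continuous_iff_continuousAt]
  intro t
  rw [ContinuousAt, tendsto_iff_norm_sub_tendsto_zero]
  have h0 : Filter.Tendsto (fun s => C * ‖D s - D t‖) (nhds t) (nhds 0) := by
    have : Continuous (fun s => C * ‖D s - D t‖) := by fun_prop
    simpa using this.tendsto t
  exact squeeze_zero (fun s => norm_nonneg _) (fun s => h _ _ (hsa s) (hsa t)) h0
end
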